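/- arXiv:2007.03633 — 10 statements merged into one kernel-verified Lean document; each statement's English description precedes it below -/
import Mathlib

section
/- Let E be a real inner product space, let λ > 0, let g : E → ℝ be a convex function, and define f : E → ℝ by f(w) = (λ/2)‖w‖² + g(w). Suppose w* ∈ E is a global minimizer of f (i.e., f(w*) ≤ f(w) for all w ∈ E). If ŵ ∈ E and ε ≥ 0 satisfy f(ŵ) ≤ f(w*) + ε, then ‖ŵ − w*‖ ≤ √(2ε/λ). -/
/-- Quadratic growth of a strongly convex function away from its minimizer. -/
theorem StrongConvexOn.quadratic_growth {E : Type*} [NormedAddCommGroup E] [NormedSpace ℝ E]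
    {s : Set E} {m : ℝ} {f : E → ℝ} {x y : E} (hf : StrongConvexOn s m f)
    (hmin : IsMinOn f s x) (hx : x ∈ s) (hy : y ∈ s) :
    m / 2 * ‖y - x‖ ^ 2 ≤ f y - f x := by
  set D := m / 2 * ‖y - x‖ ^ 2 with hD
  have hδ : f x ≤ f y := hmin hy
  have key : ∀ t : ℝ, 0 < t → t < 1 → (1 - t) * D ≤ f y - f x := by
    intro t ht0 ht1
    have hab : t + (1 - t) = 1 := by ring
    have hconv := hf.2 hy hx ht0.le (sub_nonneg.2 ht1.le) hab
    have hle : f x ≤ f (t • y + (1 - t) • x) :=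
      hmin (hf.1 hy hx ht0.le (sub_nonneg.2 ht1.le) hab)
    simp only [smul_eq_mul, ← hD] at hconv
    refine le_of_mul_le_mul_left ?_ ht0
    linarith
  by_contra! hlt
  have hDpos : 0 < D := by linarith
  have ht := key ((D - (f y - f x)) / (2 * D)) (div_pos (by linarith) (by linarith))
    ((div_lt_one (by linarith)).2 (by linarith))
  have heq : (1 - (D - (f y - f x)) / (2 * D)) * D = (D + (f y - f x)) / 2 := by
    field_simp
    ring
  linarith

/-- Strong-convexity lemma: if `f w = (lam/2)‖w‖² + g w` with `g` convex and `lam > 0`,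
`wstar` is a global minimizer of `f`, and `f what ≤ f wstar + ε`, then
`‖what - wstar‖ ≤ √(2ε/lam)`. -/
theorem stmt_0 {E : Type*} [NormedAddCommGroup E] [InnerProductSpace ℝ E]
    (lam : ℝ) (hlam : 0 < lam) (g : E → ℝ) (hg : ConvexOn ℝ Set.univ g)
    (f : E → ℝ) (hf : ∀ w, f w = lam / 2 * ‖w‖ ^ 2 + g w)
    (wstar : E) (hmin : ∀ w, f wstar ≤ f w)
    (what : E) (ε : ℝ) (hε : 0 ≤ ε) (happrox : f what ≤ f wstar + ε) :
    ‖what - wstar‖ ≤ Real.sqrt (2 * ε / lam) := by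
  have hstrong : StrongConvexOn Set.univ lam f := by
    rw [strongConvexOn_iff_convex]
    simpa [hf] using hg
  have hgrowth := hstrong.quadratic_growth (fun w _ ↦ hmin w) (Set.mem_univ wstar)
    (Set.mem_univ what)
  refine Real.le_sqrt_of_sq_le ?_
  rw [le_div_iff₀ hlam]
  linarith
end

section
/- Let n ≥ 1, let x₁ ≤ x₂ ≤ … ≤ xₙ be real numbers, let q be a real number, and let ε ≥ 0. Let k = |{ i ∈ {1,…,n} : xᵢ ≤ q }|, and suppose 1 ≤ j ≤ k and k ≤ (1+ε)·j. Define T = ∑_{i=1}^{j} (x_j − xᵢ) + j·(q − x_j). Then T ≤ ∑_{i=1}^{k} (q − xᵢ) ≤ (1+ε)·T. -/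
/-- In a sequence sorted on `{0, …, n-1}`, the first `k` terms are at most `q`, where `k` is the
number of terms at most `q`. -/
theorem le_of_lt_card_filter_le {α : Type*} [LinearOrder α] {n : ℕ} {x : ℕ → α}
    (hsorted : ∀ i j : ℕ, i ≤ j → j < n → x i ≤ x j) {q : α} {i : ℕ}
    (hi : i < ((Finset.range n).filter (fun m => x m ≤ q)).card) : x i ≤ q := by
  by_contra! hq
  have hsub : (Finset.range n).filter (fun m => x m ≤ q) ⊆ Finset.range i := by
    intro m hm
    obtain ⟨hmn, hmq⟩ := Finset.mem_filter.1 hm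
    by_contra hmi
    have him : i ≤ m := by simpa using hmi
    exact (hq.trans_le (hsorted i m him (Finset.mem_range.1 hmn))).not_ge hmq
  have hcard := Finset.card_le_card hsub
  rw [Finset.card_range] at hcard
  omega

/-- Correctness of the one-dimensional multiplicative point-estimation sketch:
for a sorted sequence `x 0 ≤ ⋯ ≤ x (n-1)`, with `k` the number of points at most `q`
and `1 ≤ j ≤ k ≤ (1+ε)·j`, the estimate
`T = ∑_{i<j} (x (j-1) - x i) + j·(q - x (j-1))`
satisfies `T ≤ ∑_{i<k} (q - x i) ≤ (1+ε)·T`. -/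
theorem stmt_4 (n : ℕ) (hn : 1 ≤ n) (x : ℕ → ℝ)
    (hsorted : ∀ i j : ℕ, i ≤ j → j < n → x i ≤ x j)
    (q ε : ℝ) (hε : 0 ≤ ε) (k j : ℕ)
    (hk : k = ((Finset.range n).filter (fun i => x i ≤ q)).card)
    (hj1 : 1 ≤ j) (hjk : j ≤ k) (hkj : (k : ℝ) ≤ (1 + ε) * (j : ℝ))
    (T : ℝ)
    (hT : T = (∑ i ∈ Finset.range j, (x (j - 1) - x i)) + (j : ℝ) * (q - x (j - 1))) :
    T ≤ ∑ i ∈ Finset.range k, (q - x i) ∧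
      ∑ i ∈ Finset.range k, (q - x i) ≤ (1 + ε) * T := by
  have hkn : k ≤ n := by
    simpa [hk] using Finset.card_filter_le (Finset.range n) (fun i => x i ≤ q)
  have hxq : ∀ i < k, x i ≤ q := fun i hi => le_of_lt_card_filter_le hsorted (hk ▸ hi)
  have hT_eq : T = ∑ i ∈ Finset.range j, (q - x i) := by
    simp only [hT, Finset.sum_sub_distrib, Finset.sum_const, Finset.card_range, nsmul_eq_mul]
    ring
  have hsplit : ∑ i ∈ Finset.range k, (q - x i) = T + ∑ i ∈ Finset.Ico j k, (q - x i) := by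
    rw [hT_eq, Finset.sum_range_add_sum_Ico _ hjk]
  have htail_nonneg : 0 ≤ ∑ i ∈ Finset.Ico j k, (q - x i) :=
    Finset.sum_nonneg fun i hi => sub_nonneg.2 (hxq i (Finset.mem_Ico.1 hi).2)
  have htail_le : ∑ i ∈ Finset.Ico j k, (q - x i) ≤ ((k : ℝ) - j) * (q - x (j - 1)) := by
    have h := Finset.sum_le_card_nsmul (Finset.Ico j k) (fun i => q - x i) (q - x (j - 1))
      fun i hi => by
        obtain ⟨hji, hik⟩ := Finset.mem_Ico.1 hi
        exact sub_le_sub_left (hsorted (j - 1) i (by omega) (by omega)) q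
    simpa [Nat.cast_sub hjk] using h
  have hT_ge : (j : ℝ) * (q - x (j - 1)) ≤ T := by
    rw [hT]
    refine le_add_of_nonneg_left (Finset.sum_nonneg fun i hi => sub_nonneg.2 ?_)
    have hij := Finset.mem_range.1 hi
    exact hsorted i (j - 1) (by omega) (by omega)
  have hgap : 0 ≤ q - x (j - 1) := sub_nonneg.2 (hxq (j - 1) (by omega))
  have htail_le_mul : ∑ i ∈ Finset.Ico j k, (q - x i) ≤ ε * T :=
    calc _ ≤ ((k : ℝ) - j) * (q - x (j - 1)) := htail_le
      _ ≤ (ε * j) * (q - x (j - 1)) := mul_le_mul_of_nonneg_right (by linarith) hgap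
      _ = ε * (j * (q - x (j - 1))) := mul_assoc _ _ _
      _ ≤ ε * T := mul_le_mul_of_nonneg_left hT_ge hε
  rw [hsplit]
  constructor <;> linarith
end

section
/- Let n ≥ 1, let x₁, …, xₙ be real numbers, let q and Z be real numbers with Z ≤ q, and let ε ≥ 0. Suppose q − Z ≤ √ε and the number of indices i with Z < xᵢ ≤ q is at most n·√ε. Then 0 ≤ ∑_{i : xᵢ ≤ q} (q − xᵢ) − ∑_{i : xᵢ ≤ Z} (q − xᵢ) ≤ n·ε. -/
/-- Error bound for the additive one-dimensional point-estimation sketch: ignoring the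
points in `(Z, q]` incurs additive error at most `n·ε` when `q - Z ≤ √ε` and there are
at most `n·√ε` such points. -/
theorem stmt_5 (n : ℕ) (hn : 1 ≤ n) (x : Fin n → ℝ) (q Z ε : ℝ)
    (hZq : Z ≤ q) (hε : 0 ≤ ε) (hdiam : q - Z ≤ Real.sqrt ε)
    (hcount : ((Finset.univ.filter (fun i : Fin n => Z < x i ∧ x i ≤ q)).card : ℝ)
        ≤ (n : ℝ) * Real.sqrt ε) :
    0 ≤ (∑ i ∈ Finset.univ.filter (fun i : Fin n => x i ≤ q), (q - x i))
        - (∑ i ∈ Finset.univ.filter (fun i : Fin n => x i ≤ Z), (q - x i)) ∧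
    (∑ i ∈ Finset.univ.filter (fun i : Fin n => x i ≤ q), (q - x i))
        - (∑ i ∈ Finset.univ.filter (fun i : Fin n => x i ≤ Z), (q - x i))
        ≤ (n : ℝ) * ε := by
  have key : (∑ i ∈ Finset.univ.filter (fun i : Fin n => x i ≤ q), (q - x i))
      - (∑ i ∈ Finset.univ.filter (fun i : Fin n => x i ≤ Z), (q - x i))
      = ∑ i ∈ Finset.univ.filter (fun i : Fin n => Z < x i ∧ x i ≤ q), (q - x i) := by
    simp only [Finset.sum_filter, ← Finset.sum_sub_distrib]
    refine Finset.sum_congr rfl fun i _ => ?_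
    split_ifs <;> grind
  rw [key]
  refine ⟨Finset.sum_nonneg fun i hi => sub_nonneg.2 (Finset.mem_filter.1 hi).2.2, ?_⟩
  calc ∑ i ∈ Finset.univ.filter (fun i : Fin n => Z < x i ∧ x i ≤ q), (q - x i)
      ≤ (Finset.univ.filter (fun i : Fin n => Z < x i ∧ x i ≤ q)).card • √ε :=
        Finset.sum_le_card_nsmul _ _ _ fun i hi => by
          linarith [(Finset.mem_filter.1 hi).2.1]
    _ ≤ (n : ℝ) * √ε * √ε := by
        rw [nsmul_eq_mul]
        gcongr
    _ = (n : ℝ) * ε := by rw [mul_assoc, Real.mul_self_sqrt hε]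
end

section
/- Let n ≥ 1, let x₁, …, xₙ be real numbers, let q and Z be real numbers with Z ≤ q, and let ε ≥ 0. Suppose q − Z ≤ ε^{1/3} and the number of indices i with Z < xᵢ ≤ q is at most n·ε^{1/3}. Then 0 ≤ ∑_{i : xᵢ ≤ q} (q − xᵢ)² − ∑_{i : xᵢ ≤ Z} (q − xᵢ)² ≤ n·ε. -/
/-- Error bound for the additive one-dimensional sketch with squared distances: ignoring
the points in `(Z, q]` incurs additive error at most `n·ε` when `q - Z ≤ ε^(1/3)` and
there are at most `n·ε^(1/3)` such points. -/
theorem stmt_6 (n : ℕ) (hn : 1 ≤ n) (x : Fin n → ℝ) (q Z ε : ℝ)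
    (hZq : Z ≤ q) (hε : 0 ≤ ε) (hdiam : q - Z ≤ ε ^ ((1 : ℝ) / 3))
    (hcount : ((Finset.univ.filter (fun i : Fin n => Z < x i ∧ x i ≤ q)).card : ℝ)
        ≤ (n : ℝ) * ε ^ ((1 : ℝ) / 3)) :
    0 ≤ (∑ i ∈ Finset.univ.filter (fun i : Fin n => x i ≤ q), (q - x i) ^ 2)
        - (∑ i ∈ Finset.univ.filter (fun i : Fin n => x i ≤ Z), (q - x i) ^ 2) ∧
    (∑ i ∈ Finset.univ.filter (fun i : Fin n => x i ≤ q), (q - x i) ^ 2)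
        - (∑ i ∈ Finset.univ.filter (fun i : Fin n => x i ≤ Z), (q - x i) ^ 2)
        ≤ (n : ℝ) * ε := by
  have hsplit : (∑ i ∈ Finset.univ.filter (fun i : Fin n => x i ≤ q), (q - x i) ^ 2)
      - (∑ i ∈ Finset.univ.filter (fun i : Fin n => x i ≤ Z), (q - x i) ^ 2)
      = ∑ i ∈ Finset.univ.filter (fun i : Fin n => Z < x i ∧ x i ≤ q), (q - x i) ^ 2 := by
    simp only [Finset.sum_filter]
    rw [← Finset.sum_sub_distrib]
    refine Finset.sum_congr rfl fun i _ => ?_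
    grind
  rw [hsplit]
  refine ⟨Finset.sum_nonneg fun i _ => sq_nonneg _, ?_⟩
  have hcube : (ε ^ ((1 : ℝ) / 3)) ^ 3 = ε := by
    rw [← Real.rpow_natCast, ← Real.rpow_mul hε]
    norm_num
  set c := ε ^ ((1 : ℝ) / 3)
  calc ∑ i ∈ Finset.univ.filter (fun i : Fin n => Z < x i ∧ x i ≤ q), (q - x i) ^ 2
      ≤ (Finset.univ.filter (fun i : Fin n => Z < x i ∧ x i ≤ q)).card • c ^ 2 := by
        refine Finset.sum_le_card_nsmul _ _ _ fun i hi => ?_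
        obtain ⟨hZ, hq⟩ := (Finset.mem_filter.mp hi).2
        exact pow_le_pow_left₀ (by linarith) (by linarith) 2
    _ ≤ (n * c) * c ^ 2 := by
        rw [nsmul_eq_mul]
        gcongr
    _ = n * ε := by
        rw [← hcube]
        ring
end

section
/- Let m ≥ 1 and t ≥ 0 be natural numbers and set i = 2t. Then ∑_{j=0}^{i} (−1)^j · C(m−1, j) · C(m+1, i−j) = (−1)^t · (C(m−1, t) − C(m−1, t−1)), where C(a, b) denotes the binomial coefficient (with C(a, b) = 0 when b < 0 or b > a). -/
open Polynomial

theorem coeff_one_sub_X_pow_eq_choose (R : Type*) [CommRing R] (n k : ℕ) :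
    ((1 - X : R[X]) ^ n).coeff k = (-1) ^ k * (n.choose k : R) := by
  have h : (1 - X : R[X]) ^ n = ((1 + X : R[X]) ^ n).comp (C (-1) * X) := by
    simp [sub_eq_add_neg]
  rw [h, comp_C_mul_X_coeff, coeff_one_add_X_pow, mul_comm]

theorem one_sub_X_pow_mul_one_add_X_pow_add_two (R : Type*) [CommRing R] (n : ℕ) :
    (1 - X : R[X]) ^ n * (1 + X) ^ (n + 2) =
      expand R 2 ((1 - X) ^ n * (1 + X)) + expand R 2 (2 * (1 - X) ^ n) * X := by
  have h : (1 - X : R[X]) ^ n * (1 + X) ^ n = (1 - X ^ 2) ^ n := by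
    rw [← mul_pow]
    congr 1
    ring
  simp only [map_mul, map_pow, map_sub, map_add, map_one, map_ofNat, expand_X]
  rw [pow_add, ← mul_assoc, h]
  ring

theorem coeff_two_mul_expand_two_mul_X (R : Type*) [CommSemiring R] (p : R[X]) (t : ℕ) :
    (expand R 2 p * X).coeff (2 * t) = 0 := by
  cases t with
  | zero => simp
  | succ t =>
    rw [show 2 * (t + 1) = 2 * t + 1 + 1 by ring, coeff_mul_X, coeff_expand two_pos,
      if_neg (by omega)]


/-- Alternating binomial convolution identity, even-index case `i = 2t`:
`∑_{j=0}^{i} (−1)^j C(m−1,j) C(m+1,i−j) = (−1)^t (C(m−1,t) − C(m−1,t−1))`,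
with the convention `C(m−1, −1) = 0` (encoded by the `if t = 0` clause). -/
theorem stmt_8 (m t : ℕ) (hm : 1 ≤ m) (i : ℕ) (hi : i = 2 * t) :
    ∑ j ∈ Finset.range (i + 1),
        ((-1 : ℤ) ^ j * ((m - 1).choose j : ℤ) * ((m + 1).choose (i - j) : ℤ))
      = (-1 : ℤ) ^ t *
        (((m - 1).choose t : ℤ) - (if t = 0 then 0 else ((m - 1).choose (t - 1) : ℤ))) := by
  subst hi
  obtain ⟨n, rfl⟩ := Nat.exists_eq_add_of_le' hm
  have hconv : ∑ j ∈ Finset.range (2 * t + 1),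
      ((-1 : ℤ) ^ j * (n.choose j : ℤ) * ((n + 2).choose (2 * t - j) : ℤ)) =
      ((1 - X : ℤ[X]) ^ n * (1 + X) ^ (n + 2)).coeff (2 * t) := by
    simp only [coeff_mul, Finset.Nat.sum_antidiagonal_eq_sum_range_succ_mk,
      coeff_one_sub_X_pow_eq_choose, coeff_one_add_X_pow]
  rw [Nat.add_sub_cancel]
  refine hconv.trans ?_
  rw [one_sub_X_pow_mul_one_add_X_pow_add_two, coeff_add, coeff_two_mul_expand_two_mul_X,
    add_zero, coeff_expand_mul' two_pos, mul_add, mul_one, coeff_add]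
  cases t with
  | zero => simp [coeff_one_sub_X_pow_eq_choose]
  | succ t =>
    rw [coeff_mul_X, coeff_one_sub_X_pow_eq_choose, coeff_one_sub_X_pow_eq_choose,
      if_neg t.succ_ne_zero, Nat.add_sub_cancel]
    ring
end

section
/- Let m ≥ 1 and t ≥ 0 be natural numbers and set i = 2t + 1. Then ∑_{j=0}^{i} (−1)^j · C(m−1, j) · C(m+1, i−j) = 2·(−1)^t · C(m−1, t), where C(a, b) denotes the binomial coefficient (with C(a, b) = 0 when b > a). -/
open Polynomial in
theorem coeff_one_sub_X_pow {R : Type*} [CommRing R] (n k : ℕ) :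
    ((1 - X : R[X]) ^ n).coeff k = (-1) ^ k * (n.choose k : R) := by
  have h : (1 - X : R[X]) ^ n = ((1 + X : R[X]) ^ n).comp (C (-1) * X) := by
    simp [sub_eq_add_neg]
  rw [h, comp_C_mul_X_coeff, coeff_one_add_X_pow, mul_comm]

open Polynomial in
theorem one_sub_X_pow_mul_one_add_X_pow {R : Type*} [CommRing R] (n : ℕ) :
    (1 - X : R[X]) ^ n * (1 + X) ^ (n + 2) =
      expand R 2 ((1 - X) ^ n * (1 + X)) + C 2 * (expand R 2 ((1 - X) ^ n) * X) := by
  have h : (1 - X : R[X]) ^ n * (1 + X) ^ n = (1 - X ^ 2) ^ n := by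
    rw [← mul_pow]
    ring
  simp only [map_mul, map_pow, map_sub, map_add, map_one, expand_X, map_ofNat]
  rw [pow_add, ← mul_assoc, h]
  ring

/-- Alternating binomial convolution identity, odd-index case `i = 2t+1`:
`∑_{j=0}^{i} (−1)^j C(m−1,j) C(m+1,i−j) = 2·(−1)^t·C(m−1,t)`. -/
theorem stmt_9 (m t : ℕ) (hm : 1 ≤ m) (i : ℕ) (hi : i = 2 * t + 1) :
    ∑ j ∈ Finset.range (i + 1),
        ((-1 : ℤ) ^ j * ((m - 1).choose j : ℤ) * ((m + 1).choose (i - j) : ℤ))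
      = 2 * (-1 : ℤ) ^ t * ((m - 1).choose t : ℤ) := by
  obtain ⟨n, rfl⟩ := Nat.exists_eq_add_of_le' hm
  subst hi
  have h := congrArg (fun p : Polynomial ℤ => p.coeff (2 * t + 1))
    (one_sub_X_pow_mul_one_add_X_pow n)
  simp only [Polynomial.coeff_mul _ ((1 + Polynomial.X) ^ (n + 2)),
    Finset.Nat.sum_antidiagonal_eq_sum_range_succ_mk, coeff_one_sub_X_pow,
    Polynomial.coeff_one_add_X_pow, Polynomial.coeff_add, Polynomial.coeff_C_mul,
    Polynomial.coeff_mul_X, Polynomial.coeff_expand_mul' two_pos,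
    Polynomial.coeff_expand two_pos, show ¬ 2 ∣ 2 * t + 1 by omega, if_false, zero_add] at h
  simpa [mul_assoc] using h
end

section
/- Let p > 0 be a real number and let d be a positive natural number divisible by 8. Then |∑_{k=0}^{d/2} (−1)^k · C(d/2, k) · (max{0, (d : ℝ) − 4k})^p| = (1/2)·|∑_{k=0}^{d/2} (−1)^k · C(d/2, k) · |(d : ℝ) − 4k|^p|, where C(a, b) denotes the binomial coefficient. -/
theorem abs_rpow_eq_max_rpow_add_max_neg_rpow {p : ℝ} (hp : p ≠ 0) (t : ℝ) :
    |t| ^ p = (max 0 t) ^ p + (max 0 (-t)) ^ p := by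
  rcases le_total 0 t with h | h
  · rw [abs_of_nonneg h, max_eq_right h, max_eq_left (by linarith), Real.zero_rpow hp, add_zero]
  · rw [abs_of_nonpos h, max_eq_left h, max_eq_right (by linarith), Real.zero_rpow hp, zero_add]

theorem sum_neg_one_pow_mul_choose_reflect {R : Type*} [CommRing R] {n : ℕ} (hn : Even n)
    (f : ℕ → R) :
    ∑ k ∈ Finset.range (n + 1), (-1 : R) ^ k * (n.choose k : R) * f (n - k) =
      ∑ k ∈ Finset.range (n + 1), (-1 : R) ^ k * (n.choose k : R) * f k := by
  rw [← Finset.sum_range_reflect]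
  refine Finset.sum_congr rfl fun k hk => ?_
  have hk : k ≤ n := Nat.lt_succ_iff.mp (Finset.mem_range.mp hk)
  have hsign : (-1 : R) ^ (n - k) = (-1) ^ k :=
    neg_one_pow_congr (by simp [Nat.even_sub hk, hn])
  rw [Nat.add_sub_cancel, Nat.choose_symm hk, Nat.sub_sub_self hk, hsign]

/-- When `8 ∣ d`, the alternating binomial sum of `φ(t) = (max 0 t)^p` over `t = d - 4k`
has absolute value exactly half that of the corresponding sum with `|t|^p`. -/
theorem stmt_10 (p : ℝ) (hp : 0 < p) (d : ℕ) (hd : 0 < d) (h8 : 8 ∣ d) :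
    |∑ k ∈ Finset.range (d / 2 + 1),
        (-1 : ℝ) ^ k * ((d / 2).choose k : ℝ) * (max 0 ((d : ℝ) - 4 * (k : ℝ))) ^ p|
      = (1 / 2) *
        |∑ k ∈ Finset.range (d / 2 + 1),
          (-1 : ℝ) ^ k * ((d / 2).choose k : ℝ) * |(d : ℝ) - 4 * (k : ℝ)| ^ p| := by
  obtain ⟨m, rfl⟩ := h8
  have hdiv : 8 * m / 2 = 4 * m := by omega
  rw [hdiv]
  have key := sum_neg_one_pow_mul_choose_reflect (n := 4 * m) ⟨2 * m, by ring⟩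
    fun k => (max 0 (((8 * m : ℕ) : ℝ) - 4 * (k : ℝ))) ^ p
  have hsum : ∑ k ∈ Finset.range (4 * m + 1), (-1 : ℝ) ^ k * ((4 * m).choose k : ℝ) *
        |((8 * m : ℕ) : ℝ) - 4 * (k : ℝ)| ^ p =
      2 * ∑ k ∈ Finset.range (4 * m + 1), (-1 : ℝ) ^ k * ((4 * m).choose k : ℝ) *
        (max 0 (((8 * m : ℕ) : ℝ) - 4 * (k : ℝ))) ^ p := by
    rw [two_mul]
    nth_rewrite 2 [← key]
    rw [← Finset.sum_add_distrib]
    refine Finset.sum_congr rfl fun k hk => ?_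
    have hk : k ≤ 4 * m := Nat.lt_succ_iff.mp (Finset.mem_range.mp hk)
    have hneg : ((8 * m : ℕ) : ℝ) - 4 * ((4 * m - k : ℕ) : ℝ) =
        -(((8 * m : ℕ) : ℝ) - 4 * (k : ℝ)) := by
      push_cast [Nat.cast_sub hk]
      ring
    rw [hneg, abs_rpow_eq_max_rpow_add_max_neg_rpow hp.ne', mul_add]
  rw [hsum, abs_mul, abs_two]
  ring
end

section
/- The inequality 4·(1 − π/6) > (π/3)·∑_{m=0}^{∞} 1/((m : ℝ) + 3/2)² holds. -/
/-- Comparing with the telescoping series `∑ (1 / (m + 1) - 1 / (m + 2))`. -/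
lemma sum_range_one_div_add_three_halves_sq_le (n : ℕ) :
    ∑ m ∈ Finset.range n, 1 / ((m : ℝ) + 3 / 2) ^ 2 ≤ 1 - 1 / ((n : ℝ) + 1) := by
  induction n with
  | zero => simp
  | succ n ih =>
    rw [Finset.sum_range_succ]
    have h : 1 / ((n : ℝ) + 3 / 2) ^ 2 ≤ 1 / ((n : ℝ) + 1) - 1 / ((n : ℝ) + 1 + 1) := by
      have e : 1 / ((n : ℝ) + 1) - 1 / ((n : ℝ) + 1 + 1) =
          1 / (((n : ℝ) + 1) * ((n : ℝ) + 1 + 1)) := by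
        field_simp
        ring
      rw [e]
      exact one_div_le_one_div_of_le (by positivity) (by nlinarith)
    push_cast
    linarith

lemma tsum_one_div_add_three_halves_sq_le_one :
    ∑' m : ℕ, 1 / ((m : ℝ) + 3 / 2) ^ 2 ≤ 1 := by
  refine Real.tsum_le_of_sum_range_le (fun m => by positivity) fun n => ?_
  have h : 0 ≤ 1 / ((n : ℝ) + 1) := by positivity
  linarith [sum_range_one_div_add_three_halves_sq_le n]

/-- The inequality `4·(1 − π/6) > (π/3)·ζ(2, 3/2)` where
`ζ(2, 3/2) = ∑_{m≥0} (m + 3/2)^{−2}`. -/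
theorem stmt_12 :
    4 * (1 - Real.pi / 6) > (Real.pi / 3) * ∑' m : ℕ, 1 / ((m : ℝ) + 3 / 2) ^ 2 := by
  have h := mul_le_of_le_one_right (by positivity : 0 ≤ Real.pi / 3)
    tsum_one_div_add_three_halves_sq_le_one
  linarith [Real.pi_lt_d2]
end

section
/- Let 0 < δ < 1/100 and λ = δ². Define G : ℝ² → ℝ by G(θ, b) = (λ/2)(θ² + b²) + (1/4)·max{0, 1 + (1−δ)θ + b} + (1/4)·max{0, 1 − (1+δ)θ − b}. Then G attains its global minimum over ℝ² at the unique point (θ₀*, b₀*) with θ₀* = (2λ(1+δ) + δ) / (2λ(1 + (1+δ)²)) and b₀* = 1 − (1+δ)·θ₀*. -/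
/-- Closed-form optimum for the lower-bound SVM instance `S₀`: with `0 < δ < 1/100` and
`lam = δ²`, the objective `G` attains its global minimum at the unique point
`(θ₀*, b₀*)` with `θ₀* = (2lam(1+δ) + δ)/(2lam(1+(1+δ)²))` and `b₀* = 1 − (1+δ)θ₀*`. -/
theorem stmt_13 (δ lam : ℝ) (hδ : 0 < δ) (hδ' : δ < 1 / 100) (hlam : lam = δ ^ 2)
    (G : ℝ → ℝ → ℝ)
    (hG : ∀ θ b, G θ b = lam / 2 * (θ ^ 2 + b ^ 2)
        + 1 / 4 * max 0 (1 + (1 - δ) * θ + b)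
        + 1 / 4 * max 0 (1 - (1 + δ) * θ - b))
    (θ₀ b₀ : ℝ)
    (hθ₀ : θ₀ = (2 * lam * (1 + δ) + δ) / (2 * lam * (1 + (1 + δ) ^ 2)))
    (hb₀ : b₀ = 1 - (1 + δ) * θ₀) :
    (∀ θ b, G θ₀ b₀ ≤ G θ b) ∧
      ∀ θ b, (∀ θ' b', G θ b ≤ G θ' b') → θ = θ₀ ∧ b = b₀ := by
  have hstat : θ₀ * δ * (2 * (1 + (1 + δ) ^ 2)) = 2 * δ * (1 + δ) + 1 := by
    rw [hθ₀, hlam]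
    field_simp
  have hupper : δ * θ₀ ≤ 3 / 10 := by
    by_contra! h
    nlinarith [mul_pos hδ hδ]
  have hlower : 1 / 5 ≤ δ * θ₀ := by
    by_contra! h
    nlinarith [mul_pos hδ hδ]
  have hb_nonpos : b₀ ≤ 0 := by
    have : 1 ≤ θ₀ := by
      by_contra! h
      nlinarith
    rw [hb₀]
    nlinarith
  have hb_lower : -1 / 4 ≤ lam * b₀ := by
    have h : lam * b₀ = δ ^ 2 - δ * (1 + δ) * (δ * θ₀) := by
      rw [hlam, hb₀]
      ring
    rw [h]
    nlinarith [mul_pos hδ hδ, mul_le_mul_of_nonneg_left hupper (by positivity : 0 ≤ δ * (1 + δ))]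
  have hlam_pos : 0 < lam := by
    rw [hlam]
    positivity
  have hmult_nonneg : 0 ≤ 1 / 4 + lam * b₀ := by linarith
  have hmult_le : 1 / 4 + lam * b₀ ≤ 1 / 4 := by nlinarith
  have hvalue : G θ₀ b₀ = lam / 2 * (θ₀ ^ 2 + b₀ ^ 2) + 1 / 4 * (1 + (1 - δ) * θ₀ + b₀) := by
    rw [hG, max_eq_right (by rw [hb₀]; linarith), max_eq_left (by rw [hb₀]; linarith)]
    ring
  have hgrad : lam * θ₀ + (1 - δ) / 4 - (1 / 4 + lam * b₀) * (1 + δ) = 0 := by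
    rw [hb₀, hlam]
    linear_combination δ / 2 * hstat
  have hgrowth : ∀ θ b,
      G θ₀ b₀ + lam / 2 * ((θ - θ₀) ^ 2 + (b - b₀) ^ 2) ≤ G θ b := by
    intro θ b
    have hα := le_max_right 0 (1 + (1 - δ) * θ + b)
    have hβ : (1 / 4 + lam * b₀) * (1 - (1 + δ) * θ - b)
        ≤ 1 / 4 * max 0 (1 - (1 + δ) * θ - b) :=
      (mul_le_mul_of_nonneg_left (le_max_right 0 _) hmult_nonneg).trans
        (mul_le_mul_of_nonneg_right hmult_le (le_max_left 0 _))
    have hid : lam / 2 * (θ ^ 2 + b ^ 2) + 1 / 4 * (1 + (1 - δ) * θ + b)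
        + (1 / 4 + lam * b₀) * (1 - (1 + δ) * θ - b)
        = G θ₀ b₀ + lam / 2 * ((θ - θ₀) ^ 2 + (b - b₀) ^ 2) := by
      rw [hvalue]
      linear_combination (θ - θ₀) * hgrad - (1 / 4 + lam * b₀) * hb₀
    rw [hG θ b, ← hid]
    linarith
  refine ⟨fun θ b => ?_, fun θ b hmin => ?_⟩
  · have := hgrowth θ b
    have : 0 ≤ lam / 2 * ((θ - θ₀) ^ 2 + (b - b₀) ^ 2) := by positivity
    linarith
  · have hle := (hgrowth θ b).trans (hmin θ₀ b₀)
    have hsum : (θ - θ₀) ^ 2 + (b - b₀) ^ 2 ≤ 0 := by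
      by_contra! h
      nlinarith [mul_pos hlam_pos h]
    have hθ : (θ - θ₀) ^ 2 = 0 := by linarith [sq_nonneg (θ - θ₀), sq_nonneg (b - b₀)]
    have hb : (b - b₀) ^ 2 = 0 := by linarith [sq_nonneg (θ - θ₀), sq_nonneg (b - b₀)]
    exact ⟨sub_eq_zero.mp (pow_eq_zero_iff two_ne_zero |>.mp hθ),
      sub_eq_zero.mp (pow_eq_zero_iff two_ne_zero |>.mp hb)⟩
end

section
/- Let 0 < δ < 1/100, λ = δ², and let n be a real number with n ≥ 1/δ². Define G₁ : ℝ² → ℝ by G₁(θ, b) = (λ/2)(θ² + b²) + (1/4)·max{0, 1 + (1−δ)θ + b} + (1/4)·max{0, 1 − (1+δ)θ − b} + (1/n)·max{0, 1 + θ + b}. Then G₁ attains its global minimum over ℝ² at the unique point (θ₁*, b₁*) with θ₁* = (2λ(1+δ) + δ(1 + 2/n)) / (2λ(1 + (1+δ)²)) and b₁* = 1 − (1+δ)·θ₁*. -/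
/-- Closed-form optimum for the lower-bound SVM instance `S₁` (with the queried point):
with `0 < δ < 1/100`, `lam = δ²` and `n ≥ 1/δ²`, the objective `G₁` attains its global
minimum at the unique point `(θ₁*, b₁*)` with
`θ₁* = (2lam(1+δ) + δ(1 + 2/n))/(2lam(1+(1+δ)²))` and `b₁* = 1 − (1+δ)θ₁*`. -/
theorem stmt_14 (δ lam n : ℝ) (hδ : 0 < δ) (hδ' : δ < 1 / 100) (hlam : lam = δ ^ 2)
    (hn : n ≥ 1 / δ ^ 2)
    (G₁ : ℝ → ℝ → ℝ)
    (hG₁ : ∀ θ b, G₁ θ b = lam / 2 * (θ ^ 2 + b ^ 2)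
        + 1 / 4 * max 0 (1 + (1 - δ) * θ + b)
        + 1 / 4 * max 0 (1 - (1 + δ) * θ - b)
        + 1 / n * max 0 (1 + θ + b))
    (θ₁ b₁ : ℝ)
    (hθ₁ : θ₁ = (2 * lam * (1 + δ) + δ * (1 + 2 / n)) / (2 * lam * (1 + (1 + δ) ^ 2)))
    (hb₁ : b₁ = 1 - (1 + δ) * θ₁) :
    (∀ θ b, G₁ θ₁ b₁ ≤ G₁ θ b) ∧
      ∀ θ b, (∀ θ' b', G₁ θ b ≤ G₁ θ' b') → θ = θ₁ ∧ b = b₁ := by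
  obtain ⟨m, hm⟩ : ∃ m, m = 1 / n := ⟨_, rfl⟩
  have hδ2 : 0 < δ ^ 2 := by positivity
  have hn0 : 0 < n := lt_of_lt_of_le (by positivity) hn
  have hm0 : 0 < m := by rw [hm]; positivity
  have hmδ : m ≤ δ ^ 2 := by
    rw [hm, div_le_iff₀ hn0]
    rwa [ge_iff_le, div_le_iff₀ hδ2, mul_comm] at hn
  have h2n : 2 / n = 2 * m := by rw [hm]; ring
  rw [h2n] at hθ₁
  -- Write `t = δ * θ₁`; the closed form determines `t` by a linear equation.
  obtain ⟨t, ht⟩ : ∃ t, t = δ * θ₁ := ⟨_, rfl⟩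
  have htD : 2 * t * (1 + (1 + δ) ^ 2) = 2 * δ * (1 + δ) + 1 + 2 * m := by
    rw [ht, hθ₁, hlam]
    field_simp
    ring
  have ht_le : t ≤ 1 := by nlinarith only [htD, hmδ, hδ, hδ', hδ2]
  have ht_ge : 1 / 5 ≤ t := by nlinarith only [htD, hm0, hδ, hδ']
  have hlb : lam * b₁ = δ ^ 2 - (1 + δ) * δ * t := by rw [hb₁, hlam, ht]; ring
  -- The multiplier of the hinge that vanishes at the optimum.
  obtain ⟨s, hs⟩ : ∃ s, s = 4 * (lam * b₁) + 1 + 4 * m := ⟨_, rfl⟩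
  have hδt : δ / 5 ≤ δ * t := by nlinarith only [hδ, ht_ge]
  have hδt' : δ * t ≤ δ := by nlinarith only [hδ, ht_le]
  have hs0 : 0 ≤ s := by rw [hs, hlb]; nlinarith only [hδt', hδ, hδ', hm0]
  have hs1 : s ≤ 1 := by rw [hs, hlb]; nlinarith only [hδt, hδ, hδ', hmδ]
  have hlθ : lam * θ₁ = δ * t := by rw [hlam, ht]; ring
  have hstat : lam * θ₁ + (1 - δ) / 4 + m - s * (1 + δ) / 4 = 0 := by
    rw [hs, hlθ, hlb]
    linear_combination δ / 2 * htD
  have hval : G₁ θ₁ b₁ = lam / 2 * (θ₁ ^ 2 + b₁ ^ 2)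
      + 1 / 4 * (1 + (1 - δ) * θ₁ + b₁) + m * (1 + θ₁ + b₁) := by
    rw [hG₁, max_eq_right (a := 0) (b := 1 + (1 - δ) * θ₁ + b₁) (by rw [hb₁]; linarith),
      max_eq_left (a := 0) (b := 1 - (1 + δ) * θ₁ - b₁) (by rw [hb₁]; linarith),
      max_eq_right (a := 0) (b := 1 + θ₁ + b₁) (by rw [hb₁]; linarith), hm]
    ring
  have key : ∀ θ b, G₁ θ₁ b₁ + lam / 2 * ((θ - θ₁) ^ 2 + (b - b₁) ^ 2) ≤ G₁ θ b := by
    intro θ b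
    have h1 := le_max_right 0 (1 + (1 - δ) * θ + b)
    have h2 : s * (1 - (1 + δ) * θ - b) ≤ max 0 (1 - (1 + δ) * θ - b) :=
      (mul_le_mul_of_nonneg_left (le_max_right _ _) hs0).trans
        (mul_le_of_le_one_left (le_max_left _ _) hs1)
    have h3 := mul_le_mul_of_nonneg_left (le_max_right 0 (1 + θ + b)) hm0.le
    have hident : G₁ θ₁ b₁ + lam / 2 * ((θ - θ₁) ^ 2 + (b - b₁) ^ 2)
        = lam / 2 * (θ ^ 2 + b ^ 2) + 1 / 4 * (1 + (1 - δ) * θ + b)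
          + 1 / 4 * (s * (1 - (1 + δ) * θ - b)) + m * (1 + θ + b) := by
      rw [hval]
      linear_combination (θ₁ - θ) * hstat + (b - b₁) / 4 * hs + s / 4 * hb₁
    rw [hident, hG₁, ← hm]
    linarith
  have hlam0 : 0 < lam := hlam ▸ hδ2
  refine ⟨fun θ b => le_trans (le_add_of_nonneg_right (by positivity)) (key θ b), ?_⟩
  intro θ b h
  have hle : lam / 2 * ((θ - θ₁) ^ 2 + (b - b₁) ^ 2) ≤ 0 := by linarith [key θ b, h θ₁ b₁]
  have hsq : (θ - θ₁) ^ 2 + (b - b₁) ^ 2 ≤ 0 := nonpos_of_mul_nonpos_right hle (by positivity)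
  have hθ2 : (θ - θ₁) ^ 2 = 0 := by linarith [sq_nonneg (θ - θ₁), sq_nonneg (b - b₁)]
  have hb2 : (b - b₁) ^ 2 = 0 := by linarith [sq_nonneg (θ - θ₁), sq_nonneg (b - b₁)]
  exact ⟨sub_eq_zero.mp (pow_eq_zero_iff two_ne_zero |>.mp hθ2),
    sub_eq_zero.mp (pow_eq_zero_iff two_ne_zero |>.mp hb2)⟩
end
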